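/- arXiv:2209.14580 — 2 statements merged into one kernel-verified Lean document; each statement's English description precedes it below -/
import Mathlib

section
/- Let q(a,x) be a d×d matrix-valued free polynomial homogeneous of degree two in x and of degree d_a in a, with m_1,…,m_N enumerating the words in a of degree at most d_a, and let Z^{j,k}_{r,t}(a) be the uniquely determined d×d matrix polynomials with q(a,x) = Σ_{j,k,r,t} (I_d ⊗ m_r(a)* x_j) Z^{j,k}_{r,t}(a) (I_d ⊗ x_k m_t(a)). Fix positive integers n, m, tuples A,X ∈ S_n(ℂ^μ), α,δ ∈ S_m(ℂ^μ) and a tuple β of n×m complex matrices β_1,…,β_μ. Set W* = (I_n 0) ∈ M_{n,n+m}(ℂ), R_j = diag(A_j, α_j) and S_j = [[X_j, β_j],[β_j*, δ_j]]. Then (I_d ⊗ W)* q(R,S) (I_d ⊗ W) = q(A,X) + V(A)[β*]* Z(α) V(A)[β*], where V(A)[β*] is the column matrix, indexed by pairs (k,t) with 1 ≤ k ≤ μ and 1 ≤ t ≤ N, with (k,t) entry I_d ⊗ β_k* m_t(A), and Z(α) is the block matrix indexed by pairs ((j,r),(k,t)) with entry Z^{j,k}_{r,t}(α). -/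
open Matrix ComplexOrder

abbrev FreeWord (μ : ℕ) := FreeMonoid (Fin μ ⊕ Fin μ)

abbrev NCPoly (N d μ : ℕ) := FreeWord μ →₀ Matrix (Fin N) (Fin d) ℂ

noncomputable def wordEval {μ : ℕ} {k : Type*} [Fintype k] [DecidableEq k]
    (X Y : Fin μ → Matrix k k ℂ) (w : FreeWord μ) : Matrix k k ℂ :=
  (w.toList.map (Sum.elim X Y)).prod

noncomputable def polyEval {N d μ : ℕ} {k : Type*} [Fintype k] [DecidableEq k]
    (p : NCPoly N d μ) (X Y : Fin μ → Matrix k k ℂ) :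
    Matrix (Fin N × k) (Fin d × k) ℂ :=
  p.sum fun w c => Matrix.kroneckerMap (· * ·) c (wordEval X Y w)

noncomputable def polyStar {N d μ : ℕ} (p : NCPoly N d μ) : NCPoly d N μ :=
  Finsupp.mapDomain (fun w => FreeMonoid.ofList w.toList.reverse)
    (Finsupp.mapRange Matrix.conjTranspose (by simp) p)

noncomputable def polyMul {a b c μ : ℕ} (p : FreeWord μ →₀ Matrix (Fin a) (Fin b) ℂ)
    (q : FreeWord μ →₀ Matrix (Fin b) (Fin c) ℂ) :
    FreeWord μ →₀ Matrix (Fin a) (Fin c) ℂ :=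
  p.sum fun u cu => q.sum fun v cv => Finsupp.single (u * v) (cu * cv)

def loewnerLE {k : Type*} [Fintype k] (A B : Matrix k k ℂ) : Prop := (B - A).PosSemidef

noncomputable def kronId {k l : Type*} (d : ℕ) (V : Matrix k l ℂ) :
    Matrix (Fin d × k) (Fin d × l) ℂ :=
  Matrix.kroneckerMap (· * ·) (1 : Matrix (Fin d) (Fin d) ℂ) V

noncomputable def compress {μ : ℕ} {k l : Type*} [Fintype k] (V : Matrix k l ℂ)
    (X : Fin μ → Matrix k k ℂ) : Fin μ → Matrix l l ℂ :=
  fun i => Vᴴ * X i * V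


/-- The degree of a word in the variables `a` (the number of letters `aᵢ`, encoded as
`Sum.inl`). -/
def degA {μ : ℕ} (w : FreeWord μ) : ℕ := (w.toList.filter Sum.isLeft).length

/-- The degree of a word in the variables `x` (the number of letters `xⱼ`, encoded as
`Sum.inr`). -/
def degX {μ : ℕ} (w : FreeWord μ) : ℕ := (w.toList.filter Sum.isRight).length

/-- `p(a,x)` is convex in `x`: for each `n`, each hermitian tuple `A`, all hermitian tuples
`X, Y` and each `0 < t < 1`, `p(A, tX+(1-t)Y) ⪯ t p(A,X) + (1-t) p(A,Y)`. -/
def IsConvexInX {d μ : ℕ} (p : NCPoly d d μ) : Prop :=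
  ∀ (n : ℕ) (A X Y : Fin μ → Matrix (Fin n) (Fin n) ℂ),
    (∀ i, (A i).IsHermitian) → (∀ i, (X i).IsHermitian) → (∀ i, (Y i).IsHermitian) →
    ∀ t : ℝ, 0 < t → t < 1 →
    loewnerLE (polyEval p A (fun i => t • X i + (1 - t) • Y i))
      (t • polyEval p A X + (1 - t) • polyEval p A Y)

/-- The word `m(a)* xⱼ = m_r(a)* x_j` appearing on the left of the middle matrix
representation: the reverse of the `a`-word `w` followed by the letter `xⱼ`. -/
def leftWord {μ : ℕ} (w : FreeMonoid (Fin μ)) (j : Fin μ) : FreeWord μ :=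
  FreeMonoid.ofList (w.toList.reverse.map Sum.inl ++ [Sum.inr j])

/-- The word `x_k m(a) = x_k m_t(a)` appearing on the right of the middle matrix
representation. -/
def rightWord {μ : ℕ} (k : Fin μ) (w : FreeMonoid (Fin μ)) : FreeWord μ :=
  FreeMonoid.ofList (Sum.inr k :: w.toList.map Sum.inl)

/-- A `d × d` matrix polynomial in the variables `a` alone, viewed as a polynomial in the
variables `a, x`. -/
noncomputable def liftA {d μ : ℕ}
    (z : FreeMonoid (Fin μ) →₀ Matrix (Fin d) (Fin d) ℂ) : NCPoly d d μ :=
  Finsupp.mapDomain (fun w => FreeMonoid.ofList (w.toList.map Sum.inl)) z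


/-- Evaluation of a word in the variables `a` alone at a tuple of square matrices. -/
noncomputable def aWordEval {μ : ℕ} {k : Type*} [Fintype k] [DecidableEq k]
    (A : Fin μ → Matrix k k ℂ) (w : FreeMonoid (Fin μ)) : Matrix k k ℂ :=
  (w.toList.map A).prod

/-- Evaluation of a `d × d` matrix polynomial in the variables `a` alone at a tuple of
square matrices, `z(α) = Σ_w z_w ⊗ w(α)`. -/
noncomputable def aPolyEval {d μ : ℕ} {k : Type*} [Fintype k] [DecidableEq k]
    (z : FreeMonoid (Fin μ) →₀ Matrix (Fin d) (Fin d) ℂ) (A : Fin μ → Matrix k k ℂ) :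
    Matrix (Fin d × k) (Fin d × k) ℂ :=
  z.sum fun w c => Matrix.kroneckerMap (· * ·) c (aWordEval A w)

/-! ### The ampliation `I_d ⊗ V` -/

section Ampliation

variable {k l o : Type*}

theorem kronId_mul [Fintype l] (d : ℕ) (U : Matrix k l ℂ) (V : Matrix l o ℂ) :
    kronId d (U * V) = kronId d U * kronId d V := by
  simpa [kronId] using
    Matrix.mul_kronecker_mul (1 : Matrix (Fin d) (Fin d) ℂ) (1 : Matrix (Fin d) (Fin d) ℂ) U V

theorem kronId_add (d : ℕ) (U V : Matrix k l ℂ) :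
    kronId d (U + V) = kronId d U + kronId d V :=
  Matrix.kronecker_add _ _ _

@[simp]
theorem kronId_zero (d : ℕ) : kronId d (0 : Matrix k l ℂ) = 0 :=
  Matrix.kronecker_zero _

@[simp]
theorem kronId_one [DecidableEq k] (d : ℕ) : kronId d (1 : Matrix k k ℂ) = 1 :=
  Matrix.one_kronecker_one

theorem conjTranspose_kronId (d : ℕ) (V : Matrix k l ℂ) :
    (kronId d V)ᴴ = kronId d Vᴴ := by
  simpa [kronId] using Matrix.conjTranspose_kronecker (1 : Matrix (Fin d) (Fin d) ℂ) V

end Ampliation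

/-! ### Evaluation of words and polynomials -/

section Evaluation

variable {μ : ℕ} {k : Type*} [Fintype k] [DecidableEq k]

theorem wordEval_mul (X Y : Fin μ → Matrix k k ℂ) (u v : FreeWord μ) :
    wordEval X Y (u * v) = wordEval X Y u * wordEval X Y v := by
  simp [wordEval, FreeMonoid.toList_mul]

theorem wordEval_map_inl (X Y : Fin μ → Matrix k k ℂ) (w : FreeMonoid (Fin μ)) :
    wordEval X Y (FreeMonoid.ofList (w.toList.map Sum.inl)) = aWordEval X w := by
  simp [wordEval, aWordEval, Function.comp_def]

theorem wordEval_rightWord (X Y : Fin μ → Matrix k k ℂ) (j : Fin μ) (w : FreeMonoid (Fin μ)) :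
    wordEval X Y (rightWord j w) = Y j * aWordEval X w := by
  simp [wordEval, aWordEval, rightWord, Function.comp_def]

theorem wordEval_leftWord {X Y : Fin μ → Matrix k k ℂ} (hX : ∀ i, (X i).IsHermitian)
    (hY : ∀ i, (Y i).IsHermitian) (w : FreeMonoid (Fin μ)) (j : Fin μ) :
    wordEval X Y (leftWord w j) = (wordEval X Y (rightWord j w))ᴴ := by
  simp [wordEval, rightWord, leftWord, Function.comp_def, Matrix.conjTranspose_list_prod,
    (hY j).eq, (hX _).eq, List.map_reverse]

theorem polyEval_zero {a b : ℕ} (X Y : Fin μ → Matrix k k ℂ) :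
    polyEval (0 : NCPoly a b μ) X Y = 0 :=
  Finsupp.sum_zero_index

theorem polyEval_single {a b : ℕ} (X Y : Fin μ → Matrix k k ℂ) (w : FreeWord μ)
    (c : Matrix (Fin a) (Fin b) ℂ) :
    polyEval (Finsupp.single w c) X Y = Matrix.kroneckerMap (· * ·) c (wordEval X Y w) :=
  Finsupp.sum_single_index (Matrix.zero_kronecker _)

theorem polyEval_add {a b : ℕ} (p q : NCPoly a b μ) (X Y : Fin μ → Matrix k k ℂ) :
    polyEval (p + q) X Y = polyEval p X Y + polyEval q X Y :=
  Finsupp.sum_add_index' (fun _ => Matrix.zero_kronecker _)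
    (fun _ _ _ => Matrix.add_kronecker _ _ _)

theorem polyEval_sum {a b : ℕ} {ι : Type*} (s : Finset ι) (p : ι → NCPoly a b μ)
    (X Y : Fin μ → Matrix k k ℂ) :
    polyEval (∑ i ∈ s, p i) X Y = ∑ i ∈ s, polyEval (p i) X Y :=
  map_sum (⟨⟨fun p => polyEval p X Y, polyEval_zero X Y⟩, fun p q => polyEval_add p q X Y⟩ :
    NCPoly a b μ →+ Matrix (Fin a × k) (Fin b × k) ℂ) p s

theorem polyEval_polyMul {a b c : ℕ} (p : NCPoly a b μ) (q : NCPoly b c μ)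
    (X Y : Fin μ → Matrix k k ℂ) :
    polyEval (polyMul p q) X Y = polyEval p X Y * polyEval q X Y := by
  simp only [polyMul, Finsupp.sum, polyEval_sum, polyEval_single, wordEval_mul]
  simp only [polyEval, Finsupp.sum, Matrix.sum_mul, Matrix.mul_sum]
  rw [Finset.sum_comm]
  refine Finset.sum_congr rfl fun v _ => Finset.sum_congr rfl fun u _ => ?_
  exact Matrix.mul_kronecker_mul _ _ _ _

theorem polyEval_liftA {d : ℕ} (z : FreeMonoid (Fin μ) →₀ Matrix (Fin d) (Fin d) ℂ)
    (X Y : Fin μ → Matrix k k ℂ) : polyEval (liftA z) X Y = aPolyEval z X := by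
  rw [polyEval, liftA, Finsupp.sum_mapDomain_index (fun _ => Matrix.zero_kronecker _)
    (fun _ _ _ => Matrix.add_kronecker _ _ _)]
  simp only [wordEval_map_inl, aPolyEval]

theorem polyEval_middle_term {d : ℕ} {X Y : Fin μ → Matrix k k ℂ}
    (hX : ∀ i, (X i).IsHermitian) (hY : ∀ i, (Y i).IsHermitian) (i j : Fin μ)
    (u v : FreeMonoid (Fin μ)) (z : FreeMonoid (Fin μ) →₀ Matrix (Fin d) (Fin d) ℂ) :
    polyEval (polyMul
        (polyMul (Finsupp.single (leftWord u i) (1 : Matrix (Fin d) (Fin d) ℂ)) (liftA z))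
        (Finsupp.single (rightWord j v) (1 : Matrix (Fin d) (Fin d) ℂ))) X Y
      = (kronId d (Y i * aWordEval X u))ᴴ * aPolyEval z X * kronId d (Y j * aWordEval X v) := by
  rw [polyEval_polyMul, polyEval_polyMul, polyEval_single, polyEval_single, polyEval_liftA,
    wordEval_leftWord hX hY, wordEval_rightWord, wordEval_rightWord, conjTranspose_kronId]
  rfl

end Evaluation

/-! ### Intertwining -/

section Intertwining

variable {μ : ℕ} {k l : Type*} [Fintype k] [DecidableEq k] [Fintype l] [DecidableEq l]

theorem aWordEval_mul_of_intertwines {B : Fin μ → Matrix k k ℂ} {C : Fin μ → Matrix l l ℂ}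
    {V : Matrix k l ℂ} (h : ∀ i, B i * V = V * C i) (w : FreeMonoid (Fin μ)) :
    aWordEval B w * V = V * aWordEval C w := by
  unfold aWordEval
  induction w.toList with
  | nil => simp
  | cons i w ih =>
    simp only [List.map_cons, List.prod_cons]
    rw [Matrix.mul_assoc, ih, ← Matrix.mul_assoc, h, Matrix.mul_assoc]

theorem aPolyEval_mul_kronId_of_intertwines {d : ℕ} {B : Fin μ → Matrix k k ℂ}
    {C : Fin μ → Matrix l l ℂ} {V : Matrix k l ℂ} (h : ∀ i, B i * V = V * C i)
    (z : FreeMonoid (Fin μ) →₀ Matrix (Fin d) (Fin d) ℂ) :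
    aPolyEval z B * kronId d V = kronId d V * aPolyEval z C := by
  simp only [aPolyEval, Finsupp.sum, Matrix.sum_mul, Matrix.mul_sum]
  refine Finset.sum_congr rfl fun w _ => ?_
  calc _ = Matrix.kronecker (z w * 1) (aWordEval B w * V) :=
        (Matrix.mul_kronecker_mul _ _ _ _).symm
    _ = Matrix.kronecker (1 * z w) (V * aWordEval C w) := by
        rw [aWordEval_mul_of_intertwines h, Matrix.mul_one, Matrix.one_mul]
    _ = _ := Matrix.mul_kronecker_mul _ _ _ _

end Intertwining

/-- The quadratic form of a block matrix at a block column is the double sum over blocks. -/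
theorem blockColumn_conjTranspose_mul_mul {ι k l : Type*} [Fintype ι] [Fintype k]
    (B : ι → Matrix k l ℂ) (M : ι → ι → Matrix k k ℂ) :
    (Matrix.of fun (i : ι × k) (y : l) => B i.1 i.2 y)ᴴ *
        (Matrix.of fun (i i' : ι × k) => M i.1 i'.1 i.2 i'.2) *
        (Matrix.of fun (i : ι × k) (y : l) => B i.1 i.2 y)
      = ∑ i, ∑ i', (B i)ᴴ * M i i' * B i' := by
  ext y y'
  simp only [Matrix.mul_apply, Matrix.sum_apply, Fintype.sum_prod_type, Finset.sum_mul,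
    Matrix.conjTranspose_apply, Matrix.of_apply]
  exact (Finset.sum_congr rfl fun i' _ => Finset.sum_comm).trans Finset.sum_comm

/-- The border vector–middle matrix evaluation identity:
`(I_d ⊗ W)* q(R,S) (I_d ⊗ W) = q(A,X) + V(A)[β*]* Z(α) V(A)[β*]`. -/
theorem border_vector_middle_matrix_identity {d μ da : ℕ} (hd : 0 < d) (hμ : 0 < μ)
    (q : NCPoly d d μ)
    (hq2 : ∀ w, q w ≠ 0 → degX w = 2)
    (hqa : ∀ w, q w ≠ 0 → degA w ≤ da)
    (N : ℕ) (hN : N = ∑ j ∈ Finset.range (da + 1), μ ^ j)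
    (mm : Fin N → FreeMonoid (Fin μ))
    (hminj : Function.Injective mm)
    (hmenum : ∀ w : FreeMonoid (Fin μ), w.toList.length ≤ da ↔ ∃ r, mm r = w)
    (Z : Fin μ → Fin μ → Fin N → Fin N → (FreeMonoid (Fin μ) →₀ Matrix (Fin d) (Fin d) ℂ))
    (hrep : q = ∑ j : Fin μ, ∑ k : Fin μ, ∑ r : Fin N, ∑ t : Fin N,
      polyMul
        (polyMul (Finsupp.single (leftWord (mm r) j) (1 : Matrix (Fin d) (Fin d) ℂ))
          (liftA (Z j k r t)))
        (Finsupp.single (rightWord k (mm t)) (1 : Matrix (Fin d) (Fin d) ℂ)))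
    (n m : ℕ) (hn : 0 < n) (hm : 0 < m)
    (A X : Fin μ → Matrix (Fin n) (Fin n) ℂ)
    (hA : ∀ i, (A i).IsHermitian) (hX : ∀ i, (X i).IsHermitian)
    (α δ : Fin μ → Matrix (Fin m) (Fin m) ℂ)
    (hα : ∀ i, (α i).IsHermitian) (hδ : ∀ i, (δ i).IsHermitian)
    (β : Fin μ → Matrix (Fin n) (Fin m) ℂ)
    (W : Matrix (Fin n ⊕ Fin m) (Fin n) ℂ)
    (hW : W = Matrix.fromRows (1 : Matrix (Fin n) (Fin n) ℂ) (0 : Matrix (Fin m) (Fin n) ℂ))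
    (R S : Fin μ → Matrix (Fin n ⊕ Fin m) (Fin n ⊕ Fin m) ℂ)
    (hR : R = fun j => Matrix.fromBlocks (A j) 0 0 (α j))
    (hS : S = fun j => Matrix.fromBlocks (X j) (β j) (β j)ᴴ (δ j))
    -- the border vector `V(A)[β*]`, a block column indexed by pairs `(k,t)` with entries
    -- `I_d ⊗ β_k* m_t(A)`
    (borderV : Matrix ((Fin μ × Fin N) × (Fin d × Fin m)) (Fin d × Fin n) ℂ)
    (hborder : borderV = fun i jj =>
      Matrix.kroneckerMap (· * ·) (1 : Matrix (Fin d) (Fin d) ℂ)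
        ((β i.1.1)ᴴ * aWordEval A (mm i.1.2)) i.2 jj)
    -- the middle matrix `Z(α)`, a block matrix indexed by pairs `((j,r),(k,t))` with
    -- entries `Z^{j,k}_{r,t}(α)`
    (Zbig : Matrix ((Fin μ × Fin N) × (Fin d × Fin m)) ((Fin μ × Fin N) × (Fin d × Fin m)) ℂ)
    (hZbig : Zbig = fun i i' => aPolyEval (Z i.1.1 i'.1.1 i.1.2 i'.1.2) α i.2 i'.2) :
    (kronId d W)ᴴ * polyEval q R S * kronId d W
      = polyEval q A X + borderVᴴ * Zbig * borderV := by
  have hR' : ∀ i, (R i).IsHermitian := fun i => by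
    subst hR
    exact (hA i).fromBlocks (by simp) (hα i)
  have hS' : ∀ i, (S i).IsHermitian := fun i => by
    subst hS
    exact (hX i).fromBlocks rfl (hδ i)
  set U : Matrix (Fin n ⊕ Fin m) (Fin m) ℂ := Matrix.fromRows 0 1 with hU
  have hRW : ∀ i, R i * W = W * A i := fun i => by
    simp [hR, hW, Matrix.fromBlocks_mul_fromRows, Matrix.fromRows_mul]
  have hRU : ∀ i, R i * U = U * α i := fun i => by
    simp [hR, hU, Matrix.fromBlocks_mul_fromRows, Matrix.fromRows_mul]
  have hSW : ∀ i, S i * W = W * X i + U * (β i)ᴴ := fun i => by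
    ext (_ | _) _ <;>
    simp [hS, hW, hU, Matrix.fromBlocks_mul_fromRows, Matrix.fromRows_mul]
  have hWW : Wᴴ * W = 1 := by
    simp [hW, Matrix.conjTranspose_fromRows_eq_fromCols_conjTranspose,
      Matrix.fromCols_mul_fromRows]
  have hUU : Uᴴ * U = 1 := by
    simp [hU, Matrix.conjTranspose_fromRows_eq_fromCols_conjTranspose,
      Matrix.fromCols_mul_fromRows]
  have hWU : Wᴴ * U = 0 := by
    simp [hW, hU, Matrix.conjTranspose_fromRows_eq_fromCols_conjTranspose,
      Matrix.fromCols_mul_fromRows]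
  have hUW : Uᴴ * W = 0 := by
    simpa using congrArg Matrix.conjTranspose hWU
  have hcol : ∀ i w, kronId d (S i * aWordEval R w) * kronId d W
      = kronId d W * kronId d (X i * aWordEval A w)
        + kronId d U * kronId d ((β i)ᴴ * aWordEval A w) := fun i w => by
    rw [← kronId_mul, ← kronId_mul, ← kronId_mul, ← kronId_add, Matrix.mul_assoc,
      aWordEval_mul_of_intertwines hRW, ← Matrix.mul_assoc, hSW, Matrix.add_mul,
      Matrix.mul_assoc, Matrix.mul_assoc]
  have hterm : ∀ i j u v (z : FreeMonoid (Fin μ) →₀ Matrix (Fin d) (Fin d) ℂ),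
      (kronId d W)ᴴ * ((kronId d (S i * aWordEval R u))ᴴ * aPolyEval z R
          * kronId d (S j * aWordEval R v)) * kronId d W
        = (kronId d (X i * aWordEval A u))ᴴ * aPolyEval z A * kronId d (X j * aWordEval A v)
          + (kronId d ((β i)ᴴ * aWordEval A u))ᴴ * aPolyEval z α
            * kronId d ((β j)ᴴ * aWordEval A v) := fun i j u v z => by
    set P := kronId d (X i * aWordEval A u)
    set Q := kronId d ((β i)ᴴ * aWordEval A u)
    set P' := kronId d (X j * aWordEval A v)
    set Q' := kronId d ((β j)ᴴ * aWordEval A v)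
    have hWW' : (kronId d W)ᴴ * kronId d W = 1 := by
      rw [conjTranspose_kronId, ← kronId_mul, hWW, kronId_one]
    have hUU' : (kronId d U)ᴴ * kronId d U = 1 := by
      rw [conjTranspose_kronId, ← kronId_mul, hUU, kronId_one]
    have hWU' : (kronId d W)ᴴ * kronId d U = 0 := by
      rw [conjTranspose_kronId, ← kronId_mul, hWU, kronId_zero]
    have hUW' : (kronId d U)ᴴ * kronId d W = 0 := by
      rw [conjTranspose_kronId, ← kronId_mul, hUW, kronId_zero]
    calc _ = (kronId d (S i * aWordEval R u) * kronId d W)ᴴ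
          * (aPolyEval z R * (kronId d (S j * aWordEval R v) * kronId d W)) := by
          simp only [Matrix.conjTranspose_mul, Matrix.mul_assoc]
      _ = (Pᴴ * (kronId d W)ᴴ + Qᴴ * (kronId d U)ᴴ)
          * (kronId d W * (aPolyEval z A * P') + kronId d U * (aPolyEval z α * Q')) := by
          rw [hcol, hcol, Matrix.conjTranspose_add, Matrix.conjTranspose_mul,
            Matrix.conjTranspose_mul, Matrix.mul_add, ← Matrix.mul_assoc, ← Matrix.mul_assoc,
            aPolyEval_mul_kronId_of_intertwines hRW, aPolyEval_mul_kronId_of_intertwines hRU,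
            Matrix.mul_assoc, Matrix.mul_assoc]
      _ = Pᴴ * ((kronId d W)ᴴ * kronId d W) * (aPolyEval z A * P')
          + Pᴴ * ((kronId d W)ᴴ * kronId d U) * (aPolyEval z α * Q')
          + Qᴴ * ((kronId d U)ᴴ * kronId d W) * (aPolyEval z A * P')
          + Qᴴ * ((kronId d U)ᴴ * kronId d U) * (aPolyEval z α * Q') := by
          simp only [Matrix.add_mul, Matrix.mul_add, Matrix.mul_assoc]
          abel
      _ = _ := by
          simp [hWW', hUU', hWU', hUW', Matrix.mul_assoc]
  have hform : borderVᴴ * Zbig * borderV = ∑ j : Fin μ, ∑ k : Fin μ, ∑ r : Fin N, ∑ t : Fin N,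
      (kronId d ((β j)ᴴ * aWordEval A (mm r)))ᴴ * aPolyEval (Z j k r t) α
        * kronId d ((β k)ᴴ * aWordEval A (mm t)) := by
    subst hborder hZbig
    refine (blockColumn_conjTranspose_mul_mul
      (fun i : Fin μ × Fin N => kronId d ((β i.1)ᴴ * aWordEval A (mm i.2)))
      (fun i i' => aPolyEval (Z i.1 i'.1 i.2 i'.2) α)).trans ?_
    simp only [Fintype.sum_prod_type]
    exact Finset.sum_congr rfl fun j _ => Finset.sum_comm
  rw [hform, hrep]
  simp only [polyEval_sum, polyEval_middle_term hR' hS', polyEval_middle_term hA hX,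
    Matrix.mul_sum, Matrix.sum_mul, hterm, Finset.sum_add_distrib]
end

section
/- Suppose p(a,x) is a hermitian d×d matrix-valued free polynomial in the freely noncommuting variables a_1,…,a_μ, x_1,…,x_μ. If p is convex in x and has degree at most two in a, then every word w with p_w ≠ 0 has degree at most two in a and in x and is not of the form a_j a_i x_k x_m or x_m x_k a_i a_j; that is, p ∈ M_d(ℂ) ⊗ span(𝓛), where 𝓛 is the set of words in a,x of degree at most two in both a and x excluding those of the forms a_j a_i x_k x_m and x_m x_k a_i a_j. -/
open Matrix ComplexOrder

/-- Symmetric weighted adjacency matrix of the edges labelled `c` in the path whose consecutive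
edges are labelled by the letters of `l`, the `k`-th edge having weight `g k`. -/
noncomputable def pathMat {α : Type*} [DecidableEq α] (l : List α) (g : ℕ → ℝ) (c : α) :
    Matrix (Fin (l.length + 1)) (Fin (l.length + 1)) ℂ := fun i j =>
  if (i : ℕ) + 1 = j ∧ l[(i : ℕ)]? = some c then (g i : ℂ)
  else if (j : ℕ) + 1 = i ∧ l[(j : ℕ)]? = some c then (g j : ℂ) else 0

theorem pathMat_isHermitian {α : Type*} [DecidableEq α] (l : List α) (g : ℕ → ℝ) (c : α) :
    (pathMat l g c).IsHermitian := by
  ext i j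
  simp only [pathMat, Matrix.conjTranspose_apply]
  split_ifs <;> first | omega | simp

theorem countP_take_succ_of_getElem? {α : Type*} {l : List α} {k : ℕ} {c : α}
    (h : l[k]? = some c) (P : α → Bool) :
    (l.take (k + 1)).countP P = (l.take k).countP P + [c].countP P := by
  rw [List.take_add_one, h, List.countP_append, Option.toList_some]

theorem exists_edge_of_pathMat_ne_zero {α : Type*} [DecidableEq α] {l : List α} {g : ℕ → ℝ}
    {c : α} {i j : Fin (l.length + 1)} (h : pathMat l g c i j ≠ 0) :
    ∃ k, l[k]? = some c ∧ ((i = k ∧ (j : ℕ) = k + 1) ∨ ((i : ℕ) = k + 1 ∧ j = k)) := by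
  unfold pathMat at h
  split_ifs at h with h1 h2
  · exact ⟨i, h1.2, Or.inl ⟨rfl, h1.1.symm⟩⟩
  · exact ⟨j, h2.2, Or.inr ⟨h2.1.symm, rfl⟩⟩
  · exact absurd rfl h

theorem exists_edge_of_pathMat_ne {α : Type*} [DecidableEq α] {l : List α} {g g' : ℕ → ℝ}
    {c : α} {i j : Fin (l.length + 1)} (h : pathMat l g c i j ≠ pathMat l g' c i j) :
    ∃ k, g k ≠ g' k ∧ l[k]? = some c ∧
      ((i = k ∧ (j : ℕ) = k + 1) ∨ ((i : ℕ) = k + 1 ∧ j = k)) := by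
  unfold pathMat at h
  split_ifs at h with h1 h2
  · exact ⟨i, fun e => h (by rw [e]), h1.2, Or.inl ⟨rfl, h1.1.symm⟩⟩
  · exact ⟨j, fun e => h (by rw [e]), h2.2, Or.inr ⟨h2.1.symm, rfl⟩⟩
  · exact absurd rfl h

/-- A walk on the path sees at least as many `P`-letters as separate its end points. -/
theorem countP_take_le_of_prod_pathMat_ne_zero {α : Type*} [DecidableEq α] {l : List α}
    {g : ℕ → ℝ} (P : α → Bool) (w : List α) :
    ∀ {i j : Fin (l.length + 1)}, (w.map (pathMat l g)).prod i j ≠ 0 →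
      (l.take j).countP P ≤ (l.take i).countP P + w.countP P := by
  induction w with
  | nil =>
    intro i j h
    have : i = j := by
      by_contra hij
      exact h (by simp [Matrix.one_apply_ne hij])
    simp [this]
  | cons c w ih =>
    intro i j h
    rw [List.map_cons, List.prod_cons, Matrix.mul_apply] at h
    obtain ⟨k, -, hk⟩ := Finset.exists_ne_zero_of_sum_ne_zero h
    have h1 := ih (right_ne_zero_of_mul hk)
    obtain ⟨e, he, hik⟩ := exists_edge_of_pathMat_ne_zero (left_ne_zero_of_mul hk)
    have h2 := countP_take_succ_of_getElem? he P
    have h3 : (c :: w).countP P = [c].countP P + w.countP P := by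
      rw [← List.countP_append]; rfl
    rcases hik with ⟨a, b⟩ | ⟨a, b⟩ <;> rw [b] at h1 <;> rw [a] <;> omega

/-- A straight walk to the end of the path must spell out the labels of the edges it uses. -/
theorem prod_pathMat_apply_last {α : Type*} [DecidableEq α] {l : List α} {g : ℕ → ℝ}
    (w : List α) : ∀ i : Fin (l.length + 1), w.length + i = l.length →
      (w.map (pathMat l g)).prod i (Fin.last _) =
        if w = l.drop i then ∏ k ∈ Finset.Ico (i : ℕ) l.length, (g k : ℂ) else 0 := by
  induction w with
  | nil =>
    intro i hi
    have hi' : i = Fin.last _ := by ext; simpa using hi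
    simp [hi']
  | cons c w ih =>
    intro i hi
    rw [List.length_cons] at hi
    have hlt : (i : ℕ) < l.length := by omega
    let i' : Fin (l.length + 1) := ⟨i + 1, by omega⟩
    rw [List.map_cons, List.prod_cons, Matrix.mul_apply, Finset.sum_eq_single i']
    · rw [ih i' (by simp only [i']; omega), List.drop_eq_getElem_cons hlt,
        Finset.prod_eq_prod_Ico_succ_bot hlt]
      simp only [pathMat, i', List.cons.injEq, List.getElem?_eq_getElem hlt, Option.some.injEq,
        true_and]
      by_cases h1 : c = l[(i : ℕ)]
      · by_cases h2 : w = l.drop (i + 1) <;> simp [h1, h2]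
      · have h2 : ¬ (i : ℕ) + 1 + 1 = i := by omega
        simp [h1, Ne.symm h1, h2]
    · intro k _ hk
      by_contra hne
      obtain ⟨e, he, hik⟩ := exists_edge_of_pathMat_ne_zero (left_ne_zero_of_mul hne)
      have h1 := countP_take_le_of_prod_pathMat_ne_zero (fun _ => true) w
        (right_ne_zero_of_mul hne)
      simp only [List.countP_true, List.length_take, Fin.val_last] at h1
      have hk' : (k : ℕ) ≠ i + 1 := fun h => hk (Fin.ext h)
      omega
    · simp

/-- If two weights agree on all edges beyond the `t`-th one, a walk distinguishing them has to
go back to that edge from both of its end points. -/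
theorem countP_take_add_le_of_prod_pathMat_ne {α : Type*} [DecidableEq α] {l : List α}
    {g g' : ℕ → ℝ} {t : ℕ} (hg : ∀ k, t < k → g k = g' k) (P : α → Bool) (w : List α) :
    ∀ {i j : Fin (l.length + 1)},
      (w.map (pathMat l g)).prod i j ≠ (w.map (pathMat l g')).prod i j →
      (l.take i).countP P + (l.take j).countP P ≤ w.countP P + 2 * (l.take t).countP P := by
  induction w with
  | nil => intro i j h; exact absurd rfl h
  | cons c w ih =>
    intro i j h
    have h3 : (c :: w).countP P = [c].countP P + w.countP P := by
      rw [← List.countP_append]; rfl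
    simp only [List.map_cons, List.prod_cons, Matrix.mul_apply] at h
    obtain ⟨k, hk⟩ : ∃ k, pathMat l g c i k * (w.map (pathMat l g)).prod k j ≠
        pathMat l g' c i k * (w.map (pathMat l g')).prod k j := by
      by_contra! hall
      exact h (Finset.sum_congr rfl fun k _ => hall k)
    by_cases hT : pathMat l g c i k = pathMat l g' c i k
    · rw [← hT] at hk
      have h1 := ih (fun e => hk (by rw [e]))
      obtain ⟨e, he, hik⟩ := exists_edge_of_pathMat_ne_zero (l := l) (g := g) (c := c) (i := i)
        (j := k) (fun e => hk (by simp [e]))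
      have h2 := countP_take_succ_of_getElem? he P
      rcases hik with ⟨a, b⟩ | ⟨a, b⟩ <;> rw [b] at h1 <;> rw [a] <;> omega
    · obtain ⟨e, hge, he, hik⟩ := exists_edge_of_pathMat_ne hT
      have het : e ≤ t := by
        by_contra hlt
        exact hge (hg e (by omega))
      have h2 := countP_take_succ_of_getElem? he P
      have h4 : (l.take e).countP P ≤ (l.take t).countP P :=
        (List.take_sublist_take_left het).countP_le
      have h1 : (l.take j).countP P ≤ (l.take k).countP P + w.countP P := by
        by_cases hz : (w.map (pathMat l g)).prod k j = 0
        · refine countP_take_le_of_prod_pathMat_ne_zero (g := g') P w fun hz' => hk ?_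
          rw [hz, hz', mul_zero, mul_zero]
        · exact countP_take_le_of_prod_pathMat_ne_zero P w hz
      rcases hik with ⟨a, b⟩ | ⟨a, b⟩ <;> rw [b] at h1 <;> rw [a] <;> omega

theorem Matrix.PosSemidef.apply_eq_zero_of_diag_eq_zero {k : Type*} [Fintype k] [DecidableEq k]
    {M : Matrix k k ℂ} (hM : M.PosSemidef) {j : k} (h : M j j = 0) (i : k) : M i j = 0 := by
  have h1 := (hM.dotProduct_mulVec_zero_iff (Pi.single j 1)).1 (by simp [h])
  simpa using congrFun h1 i

theorem polyEval_apply {N d μ : ℕ} {k : Type*} [Fintype k] [DecidableEq k]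
    (p : NCPoly N d μ) (X Y : Fin μ → Matrix k k ℂ) (a : Fin N) (b : Fin d) (i j : k) :
    polyEval p X Y (a, i) (b, j) = ∑ w ∈ p.support, p w a b * wordEval X Y w i j := by
  simp [polyEval, Finsupp.sum, Matrix.sum_apply]

theorem degA_eq_countP {μ : ℕ} (w : FreeWord μ) : degA w = w.toList.countP Sum.isLeft :=
  List.countP_eq_length_filter.symm

theorem degX_eq_countP {μ : ℕ} (w : FreeWord μ) : degX w = w.toList.countP Sum.isRight :=
  List.countP_eq_length_filter.symm

theorem length_toList_eq_degA_add_degX {μ : ℕ} (w : FreeWord μ) :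
    w.toList.length = degA w + degX w := by
  rw [List.length_eq_countP_add_countP Sum.isLeft, degA_eq_countP, degX_eq_countP]
  simp

/-- Weight on the edges of a path, equal to `σ` on the edges `s` and `t` and to `1` elsewhere. -/
def edgeWeight (s t : ℕ) (σ : ℝ) (k : ℕ) : ℝ :=
  (if s = k then σ else 1) * (if t = k then σ else 1)

theorem prod_edgeWeight {s t n : ℕ} (hs : s < n) (ht : t < n) (σ : ℝ) :
    ∏ k ∈ Finset.Ico 0 n, (edgeWeight s t σ k : ℂ) = (σ : ℂ) * σ := by
  simp only [edgeWeight, Complex.ofReal_mul, Finset.prod_mul_distrib]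
  congr 1
  · rw [Finset.prod_eq_single s] <;> simp +contextual [hs, eq_comm]
  · rw [Finset.prod_eq_single t] <;> simp +contextual [ht, eq_comm]

/-- Evaluate convexity at weighted path matrices spelling `w`, with the signs of the edges `s` and
`t` flipped between the two end points: the diagonal entry at the last vertex of the resulting
positive semidefinite matrix vanishes, while its corner entry is the coefficient of `w`. -/
theorem coeff_eq_zero_of_isConvexInX {d μ : ℕ} {p : NCPoly d d μ} (hconv : IsConvexInX p)
    (w : FreeWord μ) {s t : ℕ} (hst : s < t) {x y : Fin μ}
    (hs : w.toList[s]? = some (Sum.inr x)) (ht : w.toList[t]? = some (Sum.inr y))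
    (hmax : ∀ w', p w' ≠ 0 → degX w ≤ degX w' → degA w ≤ degA w' →
      degA w' + degX w' ≤ degA w + degX w)
    (hdiag : ∀ w', p w' ≠ 0 → 2 * (w.toList.drop t).countP Sum.isRight ≤ degX w' →
      ¬ 2 * (w.toList.drop t).countP Sum.isLeft ≤ degA w') : p w = 0 := by
  classical
  set l := w.toList with hl
  have htl : t < l.length := (List.getElem?_eq_some_iff.1 ht).1
  have hsl : s < l.length := hst.trans htl
  let T : ℝ → Fin μ ⊕ Fin μ → Matrix (Fin (l.length + 1)) (Fin (l.length + 1)) ℂ :=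
    fun σ => pathMat l (edgeWeight s t σ)
  have hA : ∀ σ i, T σ (Sum.inl i) = T 1 (Sum.inl i) := by
    intro σ i
    by_contra hne
    obtain ⟨a, ha⟩ := Function.ne_iff.1 hne
    obtain ⟨b, hb⟩ := Function.ne_iff.1 ha
    obtain ⟨k, hk, hk', -⟩ := exists_edge_of_pathMat_ne hb
    apply hk
    have h1 : s ≠ k := by rintro rfl; simp [hs] at hk'
    have h2 : t ≠ k := by rintro rfl; simp [ht] at hk'
    simp [edgeWeight, h1, h2]
  have hX : (fun i => (1 / 2 : ℝ) • T 1 (Sum.inr i) + (1 - 1 / 2 : ℝ) • T (-1) (Sum.inr i)) =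
      fun i => T 0 (Sum.inr i) := by
    funext i
    ext a b
    have hw : ∀ k, (1 / 2 : ℂ) * (edgeWeight s t 1 k : ℂ) +
        (1 - 1 / 2 : ℂ) * (edgeWeight s t (-1) k : ℂ) = (edgeWeight s t 0 k : ℂ) := by
      intro k
      have hne := hst.ne
      unfold edgeWeight
      by_cases h1 : s = k
      · have h2 : t ≠ k := by omega
        simp [h1, h2]; norm_num
      · by_cases h2 : t = k <;> simp [h1, h2] <;> norm_num
    simp only [T, pathMat, Matrix.add_apply, Matrix.smul_apply, Complex.real_smul,
      Complex.ofReal_sub, Complex.ofReal_div, Complex.ofReal_one, Complex.ofReal_ofNat]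
    split_ifs
    · exact hw _
    · exact hw _
    · simp
  have heval : ∀ σ (w' : FreeWord μ),
      wordEval (fun i => T 1 (Sum.inl i)) (fun i => T σ (Sum.inr i)) w' =
        (w'.toList.map (T σ)).prod := by
    intro σ w'
    unfold wordEval
    congr 2
    funext c
    cases c <;> simp [hA σ]
  have hpsd := hconv _ (fun i => T 1 (Sum.inl i)) (fun i => T 1 (Sum.inr i))
    (fun i => T (-1) (Sum.inr i)) (fun i => pathMat_isHermitian _ _ _)
    (fun i => pathMat_isHermitian _ _ _) (fun i => pathMat_isHermitian _ _ _)
    (1 / 2) (by norm_num) (by norm_num)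
  rw [hX, loewnerLE] at hpsd
  have hcount : ∀ P : Fin μ ⊕ Fin μ → Bool,
      l.countP P = (l.take t).countP P + (l.drop t).countP P := fun P => by
    rw [← List.countP_append, List.take_append_drop]
  have hstay : ∀ σ w', p w' ≠ 0 → (w'.toList.map (T σ)).prod (Fin.last _) (Fin.last _) =
      (w'.toList.map (T 0)).prod (Fin.last _) (Fin.last _) := by
    intro σ w' hw'
    by_contra hne
    have key := fun P => countP_take_add_le_of_prod_pathMat_ne (t := t) (fun k hk => by
      simp [edgeWeight, (hst.trans hk).ne, hk.ne]) P w'.toList hne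
    have h1 := key Sum.isRight
    have h2 := key Sum.isLeft
    have h3 := hcount Sum.isRight
    have h4 := hcount Sum.isLeft
    simp only [Fin.val_last, List.take_length] at h1 h2
    refine hdiag w' hw' ?_ ?_
    · rw [degX_eq_countP]; omega
    · rw [degA_eq_countP]; omega
  have hcross : ∀ σ w', p w' ≠ 0 → (w'.toList.map (T σ)).prod 0 (Fin.last _) =
      if w' = w then (σ : ℂ) * σ else 0 := by
    intro σ w' hw'
    have hlen : l.length = degA w + degX w := length_toList_eq_degA_add_degX w
    have hlen' := length_toList_eq_degA_add_degX w'
    by_cases hlw : w'.toList.length = l.length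
    · rw [prod_pathMat_apply_last _ 0 (by simpa using hlw)]
      simp only [Fin.val_zero, List.drop_zero, hl, EmbeddingLike.apply_eq_iff_eq]
      rw [prod_edgeWeight hsl htl]
    · rw [if_neg (fun h => hlw (by rw [h]))]
      by_contra hne
      have key := fun P => countP_take_le_of_prod_pathMat_ne_zero P w'.toList hne
      have h1 := key Sum.isRight
      have h2 := key Sum.isLeft
      simp only [Fin.val_last, List.take_length, Fin.val_zero, List.take_zero, List.countP_nil,
        zero_add, hl, ← degX_eq_countP, ← degA_eq_countP] at h1 h2
      have := hmax w' hw' h1 h2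
      omega
  by_contra hpw
  apply hpw
  ext a b
  have hd := hpsd.apply_eq_zero_of_diag_eq_zero (j := (b, Fin.last _)) (by
    simp only [Matrix.sub_apply, Matrix.add_apply, Matrix.smul_apply, polyEval_apply, heval,
      Finset.smul_sum, ← Finset.sum_add_distrib, ← Finset.sum_sub_distrib]
    refine Finset.sum_eq_zero fun w' hw' => ?_
    have hw'' := Finsupp.mem_support_iff.1 hw'
    rw [hstay 1 w' hw'', hstay (-1) w' hw'', ← add_smul]
    simp) (a, 0)
  simp only [Matrix.sub_apply, Matrix.add_apply, Matrix.smul_apply, polyEval_apply, heval,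
    Finset.smul_sum, ← Finset.sum_add_distrib, ← Finset.sum_sub_distrib] at hd
  rw [Finset.sum_eq_single w] at hd
  · simp only [hcross _ w hpw, if_true, Complex.real_smul] at hd
    push_cast at hd
    rw [Matrix.zero_apply, ← hd]
    ring
  · intro w' hw' hne
    simp [hcross _ w' (Finsupp.mem_support_iff.1 hw'), hne]
  · intro h
    exact absurd (Finsupp.mem_support_iff.2 hpw) h

theorem exists_getElem?_countP_drop {α : Type*} (P : α → Bool) :
    ∀ (l : List α) {n : ℕ}, l.countP P = n + 1 →
      ∃ s c, l[s]? = some c ∧ P c ∧ (l.drop s).countP P = n + 1 ∧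
        (l.drop (s + 1)).countP P = n
  | [], n, h => by simp at h
  | c :: l, n, h => by
    by_cases hc : P c
    · exact ⟨0, c, by simp, hc, by simpa using h, by simpa [hc] using h⟩
    · obtain ⟨s, e, h1, h2, h3, h4⟩ := exists_getElem?_countP_drop P l (n := n)
        (by simpa [hc] using h)
      exact ⟨s + 1, e, by simpa using h1, h2, by simpa using h3, by simpa using h4⟩

theorem degX_le_two_of_isConvexInX {d μ : ℕ} {p : NCPoly d d μ} (hconv : IsConvexInX p)
    (hdega : ∀ w, p w ≠ 0 → degA w ≤ 2) (w : FreeWord μ) (hw : p w ≠ 0) : degX w ≤ 2 := by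
  obtain ⟨v, hv, hmax⟩ := Finset.exists_max_image p.support (fun w => 3 * degX w + degA w)
    ⟨w, Finsupp.mem_support_iff.2 hw⟩
  by_contra! hlt
  rw [Finsupp.mem_support_iff] at hv
  have hmax' : ∀ w', p w' ≠ 0 → 3 * degX w' + degA w' ≤ 3 * degX v + degA v :=
    fun w' h => hmax w' (Finsupp.mem_support_iff.2 h)
  have hvA := hdega v hv
  have hwv := hmax' w hw
  obtain ⟨n, hn⟩ : ∃ n, degX v = n + 3 := ⟨degX v - 3, by omega⟩
  obtain ⟨s, c, hsc, hc, -, hsn⟩ := exists_getElem?_countP_drop Sum.isRight v.toList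
    (n := n + 2) (by rw [← degX_eq_countP, hn])
  obtain ⟨t, e, hte, he, htn, -⟩ := exists_getElem?_countP_drop Sum.isRight
    (v.toList.drop (s + 1)) (n := n + 1) hsn
  obtain ⟨x, rfl⟩ := Sum.isRight_iff.1 hc
  obtain ⟨y, rfl⟩ := Sum.isRight_iff.1 he
  rw [List.getElem?_drop] at hte
  rw [List.drop_drop] at htn
  refine hv (coeff_eq_zero_of_isConvexInX hconv v (by omega) hsc hte (fun w' h h1 h2 => ?_)
    fun w' h h1 => ?_)
  · have := hmax' w' h
    omega
  · have := hmax' w' h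
    omega

theorem coeff_xxaa_eq_zero_of_isConvexInX {d μ : ℕ} {p : NCPoly d d μ} (hconv : IsConvexInX p)
    (hdega : ∀ w, p w ≠ 0 → degA w ≤ 2) (i j k l : Fin μ) :
    p (FreeMonoid.ofList [Sum.inr l, Sum.inr k, Sum.inl i, Sum.inl j]) = 0 := by
  refine coeff_eq_zero_of_isConvexInX hconv _ (s := 0) (t := 1) one_pos rfl rfl
    (fun w' h h1 h2 => ?_) fun w' h h1 h2 => ?_
  · exact add_le_add (hdega w' h) (degX_le_two_of_isConvexInX hconv hdega w' h)
  · exact absurd (h2.trans (hdega w' h)) (show ¬ 2 * 2 ≤ 2 by norm_num)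

theorem polyStar_apply_reverse {N d μ : ℕ} (p : NCPoly N d μ) (w : FreeWord μ) :
    polyStar p (FreeMonoid.ofList w.toList.reverse) = (p w)ᴴ := by
  unfold polyStar
  rw [Finsupp.mapDomain_apply, Finsupp.mapRange_apply]
  intro u v h
  simpa using h

/-- If the hermitian `d × d` polynomial `p(a,x)` is convex in `x` and
has degree at most two in `a`, then every word with nonzero coefficient has degree at
most two in both `a` and `x` and is not of the form `aⱼaᵢx_kx_m` or `x_mx_ka_ia_j`;
that is, `p ∈ M_d(ℂ) ⊗ span 𝓛`. -/
theorem convexInX_degree_two_in_a_word_form {d μ : ℕ} (hd : 0 < d) (hμ : 0 < μ)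
    (p : NCPoly d d μ) (hherm : polyStar p = p) (hconv : IsConvexInX p)
    (hdega : ∀ w, p w ≠ 0 → degA w ≤ 2) :
    ∀ w, p w ≠ 0 → degA w ≤ 2 ∧ degX w ≤ 2 ∧
      (∀ i j k l : Fin μ,
        w ≠ FreeMonoid.ofList [Sum.inl j, Sum.inl i, Sum.inr k, Sum.inr l] ∧
        w ≠ FreeMonoid.ofList [Sum.inr l, Sum.inr k, Sum.inl i, Sum.inl j]) := by
  intro w hw
  refine ⟨hdega w hw, degX_le_two_of_isConvexInX hconv hdega w hw, fun i j k l => ⟨?_, ?_⟩⟩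
  · rintro rfl
    apply hw
    have h := polyStar_apply_reverse p
      (FreeMonoid.ofList [Sum.inl j, Sum.inl i, Sum.inr k, Sum.inr l])
    rw [hherm] at h
    exact Matrix.conjTranspose_eq_zero.1
      (h.symm.trans (coeff_xxaa_eq_zero_of_isConvexInX hconv hdega i j k l))
  · rintro rfl
    exact hw (coeff_xxaa_eq_zero_of_isConvexInX hconv hdega i j k l)
end
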